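/- Let q>1 be a real number, and suppose K>0 and α∈ℝ are such that |E_q(ξ)| ≤ K · exp( (log|ξ|)² / (2 log q) ) · |ξ|^α for all ξ∈ℂ∖{0}. Let ω, z ∈ ℂ∖{0} with ω ≠ z and |ω/z| > q^{α−1/2}, and let d∈ℝ be such that arg(ω/z) + d ≢ π (mod 2π). Then the integral ∫_{L_d} E_q(ξ) / Θ_q(q ω ξ / z) dξ = ∫_0^∞ E_q(r e^{id}) · Θ_q(q ω r e^{id} / z)^{−1} · e^{id} dr converges absolutely and z/(ω−z) = (q/ log q) · ∫_{L_d} E_q(ξ) / Θ_q(q ω ξ / z) dξ. -/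

import Mathlib

set_option autoImplicit false

open Complex Real MeasureTheory

/-- The Jacobi Theta function `Θ_q(z) = ∑_{n ∈ ℤ} q^{-n(n-1)/2} z^n`. -/
noncomputable def jacobiThetaQ (q : ℝ) (z : ℂ) : ℂ :=
  ∑' n : ℤ, z ^ n / (q : ℂ) ^ ((n * (n - 1)) / 2)

/-- The q-analog of the exponential `E_q(z) = ∑_{n ≥ 0} q^{-n(n-1)/2} z^n`. -/
noncomputable def Eq' (q : ℝ) (z : ℂ) : ℂ :=
  ∑' n : ℕ, z ^ n / (q : ℂ) ^ (n * (n - 1) / 2)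

/-- The reciprocal `1 / (p; p)_j` of the `q`-Pochhammer symbol, extended by zero to `j < 0`. -/
noncomputable def invPochhammer (p : ℂ) (j : ℤ) : ℂ :=
  if 0 ≤ j then (∏ k ∈ Finset.range j.toNat, (1 - p ^ (k + 1)))⁻¹ else 0

lemma triangular_succ (n : ℤ) : (n + 1) * (n + 1 - 1) / 2 = n * (n - 1) / 2 + n := by
  rw [show (n + 1) * (n + 1 - 1) = n * (n - 1) + n * 2 by ring,
    Int.add_mul_ediv_right _ _ two_ne_zero]

lemma one_sub_pow_succ_ne_zero {p : ℂ} (hp : ‖p‖ < 1) (k : ℕ) : 1 - p ^ (k + 1) ≠ 0 := by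
  intro h
  have h1 : ‖p ^ (k + 1)‖ < 1 := by
    rw [norm_pow]; exact pow_lt_one₀ (norm_nonneg _) hp (Nat.succ_ne_zero k)
  rw [← sub_eq_zero.mp h] at h1
  simp at h1

lemma invPochhammer_mul {p : ℂ} (hp : ‖p‖ < 1) (j : ℤ) :
    invPochhammer p j * (1 - p ^ j) = invPochhammer p (j - 1) := by
  rcases lt_trichotomy j 0 with hj | rfl | hj
  · simp [invPochhammer, hj.not_ge, show ¬ (1 ≤ j) by lia]
  · simp [invPochhammer]
  · obtain ⟨m, rfl⟩ : ∃ m : ℕ, j = m + 1 := ⟨(j - 1).toNat, by lia⟩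
    have h := one_sub_pow_succ_ne_zero hp m
    have h1 : ((m : ℤ) + 1).toNat = m + 1 := by lia
    have h2 : p ^ ((m : ℤ) + 1) = p ^ (m + 1) := by exact_mod_cast zpow_natCast p (m + 1)
    simp only [invPochhammer, show (0 : ℤ) ≤ m + 1 by lia, if_true, h1, h2, add_sub_cancel_right,
      Int.natCast_nonneg, Int.toNat_natCast, Finset.prod_range_succ]
    field_simp

/-- The finite form of the Jacobi triple product identity. -/
lemma hasSum_finite_triple_product {p x : ℂ} (hp : ‖p‖ < 1) (hp0 : p ≠ 0) (hx : x ≠ 0) (A B : ℕ) :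
    HasSum (fun n : ℤ => (∏ k ∈ Finset.range (A + B), (1 - p ^ (k + 1))) *
        (invPochhammer p (B + n) * invPochhammer p (A - n)) * (p ^ (n * (n - 1) / 2) * x ^ n))
      ((∏ k ∈ Finset.range A, (1 + x * p ^ k)) *
        ∏ k ∈ Finset.range B, (1 + p ^ (k + 1) / x)) := by
  induction A with
  | zero =>
    induction B with
    | zero =>
      have h (n : ℤ) (hn : n ≠ 0) : invPochhammer p n * invPochhammer p (-n) = 0 := by
        rcases lt_or_gt_of_ne hn with h | h <;> simp [invPochhammer, h.not_ge]
      have h1 := hasSum_single (f := fun n : ℤ => invPochhammer p n * invPochhammer p (-n) *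
        (p ^ (n * (n - 1) / 2) * x ^ n)) 0 fun n hn => by simp [h n hn]
      simpa [invPochhammer] using h1
    | succ B ih =>
      have ih' := ((Equiv.addRight (1 : ℤ)).hasSum_iff.mpr ih).mul_right (p ^ (B + 1) / x)
      convert! ih.add ih' using 1
      · funext n
        have e1 := invPochhammer_mul hp (B + 1 + n)
        have e2 := invPochhammer_mul hp (-n)
        have e3 : p ^ ((B : ℤ) + 1 + n) = p ^ (B + 1) * p ^ n := by
          rw [zpow_add₀ hp0]; norm_cast
        have e4 : p ^ (-n) * p ^ n = 1 := by rw [← zpow_add₀ hp0]; simp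
        rw [show (B : ℤ) + 1 + n - 1 = B + n by ring] at e1
        rw [e3] at e1
        simp only [Function.comp, Equiv.coe_addRight, triangular_succ, zpow_add₀ hp0,
          zpow_add_one₀ hx, zero_add, Finset.prod_range_succ, Nat.cast_add, Nat.cast_one,
          CharP.cast_eq_zero, zero_sub]
        rw [show (B : ℤ) + (n + 1) = B + 1 + n by ring, show -(n + 1) = -n - 1 by ring, ← e1, ← e2]
        field_simp
        linear_combination (∏ k ∈ Finset.range B, (1 - p ^ (k + 1))) * invPochhammer p (B + 1 + n) *
          invPochhammer p (-n) * p * p ^ B * e4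
      · rw [Finset.prod_range_succ]; ring
  | succ A ih =>
    have ih' := ((Equiv.subRight (1 : ℤ)).hasSum_iff.mpr ih).mul_right (x * p ^ A)
    convert! ih.add ih' using 1
    · funext m
      obtain ⟨n, rfl⟩ : ∃ n, m = n + 1 := ⟨m - 1, by ring⟩
      have e1 := invPochhammer_mul hp (B + 1 + n)
      have e2 := invPochhammer_mul hp (A - n)
      have e3 : p ^ ((B : ℤ) + 1 + n) = p ^ (B + 1) * p ^ n := by
        rw [zpow_add₀ hp0]; norm_cast
      have e4 : p ^ ((A : ℤ) - n) * p ^ n = p ^ A := by rw [← zpow_add₀ hp0]; simp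
      rw [show (B : ℤ) + 1 + n - 1 = B + n by ring] at e1
      rw [e3] at e1
      have e5 : p ^ ((n + 1) * (n + 1 - 1) / 2) = p ^ (n * (n - 1) / 2) * p ^ n := by
        rw [triangular_succ, zpow_add₀ hp0]
      simp only [Function.comp, e5]
      simp only [Equiv.subRight_apply, zpow_add_one₀ hx, show A + 1 + B = A + B + 1 by ring,
        Finset.prod_range_succ, Nat.cast_add, Nat.cast_one, add_sub_cancel_right]
      rw [show (B : ℤ) + (n + 1) = B + 1 + n by ring,
        show (A : ℤ) + 1 - (n + 1) = A - n by ring,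
        show (A : ℤ) - (n + 1) = A - n - 1 by ring, ← e1, ← e2, ← e4]
      field_simp
      linear_combination (∏ k ∈ Finset.range (A + B), (1 - p ^ (k + 1))) *
        invPochhammer p (B + 1 + n) * invPochhammer p (A - n) * p * p ^ B * e4
    · rw [Finset.prod_range_succ]; ring

open Filter Topology

lemma norm_pow_succ_summable {p : ℂ} (hp : ‖p‖ < 1) (c : ℂ) :
    Summable fun k : ℕ => ‖c * p ^ k‖ := by
  simp only [norm_mul, norm_pow]
  exact (summable_geometric_of_lt_one (norm_nonneg _) hp).mul_left _

lemma exists_tendsto_prod_one_add {p : ℂ} (hp : ‖p‖ < 1) (c : ℂ) (hc : ∀ k : ℕ, 1 + c * p ^ k ≠ 0) :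
    ∃ L ≠ 0, Tendsto (fun N => ∏ k ∈ Finset.range N, (1 + c * p ^ k)) atTop (𝓝 L) :=
  ⟨_, tprod_one_add_ne_zero_of_summable hc (norm_pow_succ_summable hp c),
    (multipliable_one_add_of_summable (norm_pow_succ_summable hp c)).hasProd.tendsto_prod_nat⟩

/-- A bilateral theta series vanishes only at the zeros of the factors of its triple product. -/
lemma tsum_theta_ne_zero {p x : ℂ} (hp : ‖p‖ < 1) (hp0 : p ≠ 0) (hx : x ≠ 0)
    (h1 : ∀ k : ℕ, 1 + x * p ^ k ≠ 0) (h2 : ∀ k : ℕ, 1 + p ^ (k + 1) / x ≠ 0)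
    (hs : Summable fun n : ℤ => p ^ (n * (n - 1) / 2) * x ^ n) :
    ∑' n : ℤ, p ^ (n * (n - 1) / 2) * x ^ n ≠ 0 := by
  obtain ⟨L₁, hL₁, ht₁⟩ := exists_tendsto_prod_one_add hp x h1
  obtain ⟨L₂, hL₂, ht₂⟩ := exists_tendsto_prod_one_add hp (p / x) fun k => by
    convert! h2 k using 2; ring
  obtain ⟨L, hL, ht⟩ := exists_tendsto_prod_one_add hp (-p) fun k => by
    convert! one_sub_pow_succ_ne_zero hp k using 1; ring
  replace ht : Tendsto (fun N => ∏ k ∈ Finset.range N, (1 - p ^ (k + 1))) atTop (𝓝 L) := by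
    refine ht.congr fun N => Finset.prod_congr rfl fun k _ => by ring
  have hv := ht.inv₀ hL
  have hu : Tendsto (invPochhammer p) atTop (𝓝 L⁻¹) := by
    have h : Tendsto Int.toNat atTop atTop :=
      tendsto_atTop.2 fun b => (eventually_ge_atTop (b : ℤ)).mono fun a ha => by lia
    refine (hv.comp h).congr' ((eventually_ge_atTop 0).mono fun a ha => ?_)
    simp [invPochhammer, ha]
  obtain ⟨C, hC⟩ : ∃ C, ∀ j, ‖invPochhammer p j‖ ≤ C := by
    obtain ⟨C, hC⟩ := (Metric.isBounded_range_of_tendsto _ hv).exists_norm_le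
    have hC' (M : ℕ) := hC _ ⟨M, rfl⟩
    refine ⟨C, fun j => ?_⟩
    unfold invPochhammer
    split_ifs
    · exact hC' _
    · simpa using (norm_nonneg _).trans (hC' 0)
  obtain ⟨D, hD⟩ := (Metric.isBounded_range_of_tendsto _ ht).exists_norm_le
  have hD' (M : ℕ) := hD _ ⟨M, rfl⟩
  have hD0 : 0 ≤ D := (norm_nonneg _).trans (hD' 0)
  have hC0 : 0 ≤ C := (norm_nonneg _).trans (hC 0)
  have hcast : Tendsto (fun N : ℕ => (N : ℤ)) atTop atTop := tendsto_natCast_atTop_atTop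
  have key := tendsto_tsum_of_dominated_convergence (𝓕 := atTop)
    (f := fun (N : ℕ) (n : ℤ) => (∏ k ∈ Finset.range (N + N), (1 - p ^ (k + 1))) *
        (invPochhammer p (N + n) * invPochhammer p (N - n)) * (p ^ (n * (n - 1) / 2) * x ^ n))
    (g := fun n => L * (L⁻¹ * L⁻¹) * (p ^ (n * (n - 1) / 2) * x ^ n))
    (bound := fun n => D * (C * C) * ‖p ^ (n * (n - 1) / 2) * x ^ n‖)
    (hs.norm.mul_left _) (fun n => by
      refine Tendsto.mul_const _ (Tendsto.mul ?_ (Tendsto.mul ?_ ?_))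
      · exact ht.comp (tendsto_atTop_mono (fun N => Nat.le_add_left N N) tendsto_id)
      · exact hu.comp (tendsto_atTop_add_const_right _ _ hcast)
      · simpa only [sub_eq_add_neg] using! hu.comp (tendsto_atTop_add_const_right _ (-n) hcast))
    (Eventually.of_forall fun N n => by
      rw [norm_mul, norm_mul, norm_mul]
      gcongr
      exacts [hD' _, hC _, hC _])
  simp only [(hasSum_finite_triple_product hp hp0 hx _ _).tsum_eq] at key
  have key' := tendsto_nhds_unique key (ht₁.mul (ht₂.congr fun N =>
    Finset.prod_congr rfl fun k _ => by ring))
  rw [tsum_mul_left] at key'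
  intro h0
  rw [h0, mul_zero] at key'
  exact mul_ne_zero hL₁ hL₂ key'.symm

lemma triangular_add (m k : ℤ) :
    (m + k) * (m + k - 1) / 2 = m * (m - 1) / 2 + k * (k - 1) / 2 + k * m := by
  have h (n : ℤ) : 2 * (n * (n - 1) / 2) = n * (n - 1) :=
    Int.mul_ediv_cancel' (Int.even_mul_pred_self n).two_dvd
  have h1 := h m
  have h2 := h k
  have h3 := h (m + k)
  have : (m + k) * (m + k - 1) = m * (m - 1) + k * (k - 1) + 2 * (k * m) := by ring
  lia

section JacobiThetaQ

variable {q : ℝ}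

lemma jacobiThetaQ_term_exp (hq : 1 < q) (n : ℤ) (w : ℂ) :
    cexp w ^ n / (q : ℂ) ^ (n * (n - 1) / 2) =
      jacobiTheta₂_term n ((w + Real.log q / 2) / (2 * π * I)) (Real.log q / (2 * π) * I) := by
  have hq' : (q : ℂ) = cexp (Real.log q) := by
    rw [← Complex.ofReal_exp, Real.exp_log (by linarith)]
  have h2 : ((n * (n - 1) / 2 : ℤ) : ℂ) = n * (n - 1) / 2 := by
    have h := Int.mul_ediv_cancel' (Int.even_mul_pred_self n).two_dvd
    have h' : (2 : ℂ) * ((n * (n - 1) / 2 : ℤ) : ℂ) = n * (n - 1) := by exact_mod_cast h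
    linear_combination h' / 2
  have hpi : (π : ℂ) ≠ 0 := by exact_mod_cast Real.pi_ne_zero
  conv_lhs => rw [hq', ← Complex.exp_int_mul, ← Complex.exp_int_mul, ← Complex.exp_sub, h2]
  rw [jacobiTheta₂_term]
  congr 1
  field_simp
  rw [I_sq]
  ring

lemma jacobiThetaQ_tau_im_pos (hq : 1 < q) : 0 < ((Real.log q / (2 * π) * I : ℂ)).im := by
  have : (Real.log q / (2 * π) * I : ℂ) = ((Real.log q / (2 * π) : ℝ) : ℂ) * I := by push_cast; rfl
  rw [this, Complex.im_ofReal_mul, I_im, mul_one]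
  have := Real.log_pos hq
  positivity

lemma summable_jacobiThetaQ (hq : 1 < q) {z : ℂ} (hz : z ≠ 0) :
    Summable fun n : ℤ => z ^ n / (q : ℂ) ^ (n * (n - 1) / 2) := by
  rw [← Complex.exp_log hz]
  simp only [jacobiThetaQ_term_exp hq]
  exact (summable_jacobiTheta₂_term_iff _ _).mpr (jacobiThetaQ_tau_im_pos hq)

lemma continuous_jacobiThetaQ_exp (hq : 1 < q) : Continuous fun w => jacobiThetaQ q (cexp w) := by
  have h (w : ℂ) : jacobiThetaQ q (cexp w) =
      jacobiTheta₂ ((w + Real.log q / 2) / (2 * π * I)) (Real.log q / (2 * π) * I) :=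
    tsum_congr fun n => jacobiThetaQ_term_exp hq n w
  simp only [h]
  have hd : Differentiable ℂ fun z => jacobiTheta₂ z (Real.log q / (2 * π) * I) :=
    fun z => differentiableAt_jacobiTheta₂_fst z (jacobiThetaQ_tau_im_pos hq)
  exact hd.continuous.comp (by fun_prop)

lemma jacobiThetaQ_shift (hq : 1 < q) {x : ℂ} (hx : x ≠ 0) (k : ℤ) :
    x ^ k / (q : ℂ) ^ (k * (k - 1) / 2) * jacobiThetaQ q ((q : ℂ) ^ (-k) * x) =
      jacobiThetaQ q x := by
  have hq0 : (q : ℂ) ≠ 0 := by exact_mod_cast (by linarith : q ≠ 0)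
  rw [jacobiThetaQ, jacobiThetaQ, ← tsum_mul_left,
    ← (Equiv.addRight k).tsum_eq fun n : ℤ => x ^ n / (q : ℂ) ^ (n * (n - 1) / 2)]
  refine tsum_congr fun m => ?_
  rw [Equiv.coe_addRight, triangular_add, zpow_add₀ hq0, zpow_add₀ hq0, zpow_add₀ hx, mul_zpow,
    ← zpow_mul, neg_mul, zpow_neg]
  field_simp

lemma jacobiThetaQ_mul (hq : 1 < q) {x : ℂ} (hx : x ≠ 0) :
    jacobiThetaQ q (q * x) = q * x * jacobiThetaQ q x := by
  have hq0 : (q : ℂ) ≠ 0 := by exact_mod_cast (by linarith : q ≠ 0)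
  have h := jacobiThetaQ_shift hq hx (-1)
  norm_num at h
  rw [← h]
  field_simp

lemma tsum_inv_jacobiThetaQ (hq : 1 < q) {x : ℂ} (hx : x ≠ 0) (h0 : jacobiThetaQ q x ≠ 0) :
    ∑' n : ℤ, (jacobiThetaQ q ((q : ℂ) ^ n * x))⁻¹ = 1 := by
  have h (n : ℤ) : (jacobiThetaQ q ((q : ℂ) ^ (-n) * x))⁻¹ =
      x ^ n / (q : ℂ) ^ (n * (n - 1) / 2) * (jacobiThetaQ q x)⁻¹ := by
    have h1 := jacobiThetaQ_shift hq hx n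
    have h2 : jacobiThetaQ q ((q : ℂ) ^ (-n) * x) ≠ 0 := fun h => h0 (by rw [← h1, h, mul_zero])
    rw [← h1] at h0 ⊢
    have h3 := left_ne_zero_of_mul h0
    rw [mul_inv, mul_inv_cancel_left₀ h3]
  rw [← (Equiv.neg ℤ).tsum_eq]
  simp only [Equiv.neg_apply, h, tsum_mul_right]
  exact mul_inv_cancel₀ h0

lemma jacobiThetaQ_exp_ne_zero (hq : 1 < q) {θ : ℝ} (hθ : ∀ ℓ : ℤ, θ ≠ π + 2 * π * ℓ) (s : ℝ) :
    jacobiThetaQ q (cexp (s + θ * I)) ≠ 0 := by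
  have hq1 : 0 < q := by linarith
  have hq0 : (q : ℂ) ≠ 0 := by exact_mod_cast hq1.ne'
  set x := cexp (s + θ * I) with hxdef
  have hx : x ≠ 0 := Complex.exp_ne_zero _
  have hneg (c : ℝ) (hc : 0 < c) : x ≠ -c := by
    intro h
    have h1 : (-c : ℂ) = cexp (Real.log c + π * I) := by
      rw [Complex.exp_add, ← Complex.ofReal_exp, Real.exp_log hc, Complex.exp_pi_mul_I]; ring
    rw [h1, hxdef, Complex.exp_eq_exp_iff_exists_int] at h
    obtain ⟨n, hn⟩ := h
    have := congrArg Complex.im hn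
    simp at this
    exact hθ n (by linarith)
  have hterm (n : ℤ) : x ^ n / (q : ℂ) ^ (n * (n - 1) / 2) =
      (q : ℂ)⁻¹ ^ (n * (n - 1) / 2) * x ^ n := by
    rw [inv_zpow, div_eq_inv_mul]
  have hs := summable_jacobiThetaQ hq hx
  unfold jacobiThetaQ
  simp only [hterm] at hs ⊢
  refine tsum_theta_ne_zero ?_ (inv_ne_zero hq0) hx (fun k h => ?_) (fun k h => ?_) hs
  · rw [norm_inv, Complex.norm_real, Real.norm_of_nonneg hq1.le]
    exact inv_lt_one_of_one_lt₀ hq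
  · refine hneg (q ^ k) (by positivity) ?_
    rw [inv_pow] at h
    push_cast
    field_simp at h
    linear_combination h
  · refine hneg ((q ^ (k + 1))⁻¹) (by positivity) ?_
    rw [inv_pow] at h
    push_cast
    field_simp at h ⊢
    linear_combination h

lemma exists_jacobiThetaQ_lower_bound (hq : 1 < q) {θ : ℝ} (hθ : ∀ ℓ : ℤ, θ ≠ π + 2 * π * ℓ) :
    ∃ C > 0, ∀ s : ℝ, C * Real.exp (s ^ 2 / (2 * Real.log q) + s / 2) ≤
      ‖jacobiThetaQ q (cexp (s + θ * I))‖ := by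
  have hl := Real.log_pos hq
  set l := Real.log q with hldef
  have hq' : (q : ℂ) = cexp l := by
    rw [← Complex.ofReal_exp, Real.exp_log (by linarith)]
  set h : ℝ → ℝ := fun s => ‖jacobiThetaQ q (cexp (s + θ * I))‖ *
    Real.exp (-(s ^ 2 / (2 * l) + s / 2)) with hh
  have hcont : Continuous h :=
    ((continuous_jacobiThetaQ_exp hq).comp (by fun_prop)).norm.mul (by fun_prop)
  have hper : Function.Periodic h l := fun s => by
    have h1 : cexp ((s + l : ℝ) + θ * I) = q * cexp (s + θ * I) := by
      rw [hq', ← Complex.exp_add]; push_cast; ring_nf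
    simp only [hh]
    rw [h1, jacobiThetaQ_mul hq (Complex.exp_ne_zero _), norm_mul, norm_mul, Complex.norm_exp, hq',
      Complex.norm_exp]
    simp only [Complex.ofReal_re, Complex.add_re, Complex.mul_re, Complex.I_re, mul_zero,
      Complex.ofReal_im, Complex.I_im, zero_mul, sub_zero, add_zero]
    have h2 : Real.exp l * Real.exp s * Real.exp (-((s + l) ^ 2 / (2 * l) + (s + l) / 2)) =
        Real.exp (-(s ^ 2 / (2 * l) + s / 2)) := by
      rw [← Real.exp_add, ← Real.exp_add]
      congr 1
      field_simp
      ring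
    rw [← h2]
    ring
  obtain ⟨s₀, -, hs₀⟩ := isCompact_Icc.exists_isMinOn (Set.nonempty_Icc.2 hl.le) hcont.continuousOn
  refine ⟨h s₀, mul_pos (norm_pos_iff.2 (jacobiThetaQ_exp_ne_zero hq hθ s₀)) (Real.exp_pos _),
    fun s => ?_⟩
  obtain ⟨y, hy, hys⟩ := hper.exists_mem_Ico₀ hl s
  have h3 : h s₀ ≤ h s := hys ▸ hs₀ (Set.Ico_subset_Icc_self hy)
  calc h s₀ * Real.exp (s ^ 2 / (2 * l) + s / 2) ≤ h s * Real.exp (s ^ 2 / (2 * l) + s / 2) := by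
        gcongr
    _ = _ := by simp only [hh]; rw [mul_assoc, ← Real.exp_add, neg_add_cancel, Real.exp_zero, mul_one]

end JacobiThetaQ

section ThetaIntegral

open Set

lemma integral_eq_setIntegral_tsum_translates {f : ℝ → ℂ} (hf : Integrable f) {l : ℝ} (hl : 0 < l) :
    ∫ s, f s = ∫ s in Ioc 0 l, ∑' n : ℤ, f (s + n * l) := by
  have hmeas (n : ℤ) : MeasurableSet (Ioc (n • l) ((n + 1) • l)) := measurableSet_Ioc
  have hdisj := pairwise_disjoint_Ioc_zsmul l
  have hcov := iUnion_Ioc_zsmul hl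
  have htrans {E : Type} [NormedAddCommGroup E] [NormedSpace ℝ E] (g : ℝ → E) (n : ℤ) :
      ∫ s in Ioc (n • l) ((n + 1) • l), g s = ∫ s in Ioc 0 l, g (s + n * l) := by
    have hle : n * l ≤ (n + 1) * l := by nlinarith
    simp only [zsmul_eq_mul, Int.cast_add, Int.cast_one]
    rw [← intervalIntegral.integral_of_le hle, ← intervalIntegral.integral_of_le hl.le,
      intervalIntegral.integral_comp_add_right]
    congr 1 <;> ring
  have hsum {E : Type} [NormedAddCommGroup E] [NormedSpace ℝ E] {g : ℝ → E} (hg : Integrable g) :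
      HasSum (fun n : ℤ => ∫ s in Ioc 0 l, g (s + n * l)) (∫ s, g s) := by
    have := hasSum_integral_iUnion hmeas hdisj hg.integrableOn
    rw [hcov, setIntegral_univ] at this
    simpa only [htrans] using this
  rw [← (hsum hf).tsum_eq]
  exact integral_tsum_of_summable_integral_norm
    (fun n => (hf.comp_add_right (n * l)).integrableOn) (hsum hf.norm).summable

lemma integral_Ioi_inv_smul_comp_log (f : ℝ → ℂ) :
    ∫ r in Ioi (0 : ℝ), r⁻¹ • f (Real.log r) = ∫ s, f s := by
  have h := integral_image_eq_integral_abs_deriv_smul MeasurableSet.univ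
    (fun x _ => (Real.hasDerivAt_exp x).hasDerivWithinAt) Real.exp_injective.injOn
    fun r => r⁻¹ • f (Real.log r)
  rw [image_univ, Real.range_exp, setIntegral_univ] at h
  rw [h]
  congr 1 with s
  simp [abs_of_pos (Real.exp_pos s)]

variable {q : ℝ} {θ : ℝ}

lemma integrable_inv_jacobiThetaQ_exp (hq : 1 < q) (hθ : ∀ ℓ : ℤ, θ ≠ π + 2 * π * ℓ) :
    Integrable fun s : ℝ => (jacobiThetaQ q (cexp (s + θ * I)))⁻¹ := by
  obtain ⟨C, hC, hb⟩ := exists_jacobiThetaQ_lower_bound hq hθ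
  have hl := Real.log_pos hq
  set l := Real.log q
  have hcont : Continuous fun s : ℝ => (jacobiThetaQ q (cexp (s + θ * I)))⁻¹ :=
    ((continuous_jacobiThetaQ_exp hq).comp (by fun_prop)).inv₀ (jacobiThetaQ_exp_ne_zero hq hθ)
  have hg := ((integrable_exp_neg_mul_sq (b := 1 / (2 * l)) (by positivity)).comp_add_right
    (l / 2)).const_mul (C⁻¹ * Real.exp (l / 8))
  refine hg.mono' hcont.aestronglyMeasurable (ae_of_all _ fun s => ?_)
  rw [norm_inv]
  have h := inv_anti₀ (mul_pos hC (Real.exp_pos _)) (hb s)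
  refine h.trans_eq ?_
  rw [mul_inv, ← Real.exp_neg, mul_assoc, ← Real.exp_add]
  congr 2
  field_simp
  ring

lemma integral_inv_jacobiThetaQ_exp (hq : 1 < q) (hθ : ∀ ℓ : ℤ, θ ≠ π + 2 * π * ℓ) :
    ∫ s : ℝ, (jacobiThetaQ q (cexp (s + θ * I)))⁻¹ = Real.log q := by
  have hl := Real.log_pos hq
  rw [integral_eq_setIntegral_tsum_translates (integrable_inv_jacobiThetaQ_exp hq hθ) hl]
  have hq' : (q : ℂ) = cexp (Real.log q) := by
    rw [← Complex.ofReal_exp, Real.exp_log (by linarith)]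
  have h (s : ℝ) : ∑' n : ℤ, (jacobiThetaQ q (cexp ((s + n * Real.log q : ℝ) + θ * I)))⁻¹ = 1 := by
    rw [← tsum_inv_jacobiThetaQ hq (Complex.exp_ne_zero _) (jacobiThetaQ_exp_ne_zero hq hθ s)]
    refine tsum_congr fun n => ?_
    rw [hq', ← Complex.exp_int_mul, ← Complex.exp_add]
    push_cast
    ring_nf
  simp only [h]
  simp [hl.le]

end ThetaIntegral

section QExponential

variable {q : ℝ}

lemma summable_norm_qExp (hq : 1 < q) (z : ℂ) :
    Summable fun n : ℕ => ‖z ^ n / (q : ℂ) ^ (n * (n - 1) / 2)‖ := by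
  rcases eq_or_ne z 0 with rfl | hz
  · refine summable_of_ne_finset_zero (s := {0}) fun n hn => ?_
    simp [Finset.mem_singleton.not.mp hn]
  · have h := ((summable_jacobiThetaQ hq hz).comp_injective Nat.cast_injective).norm
    refine h.congr fun n => ?_
    have : (n : ℤ) * (n - 1) / 2 = ((n * (n - 1) / 2 : ℕ) : ℤ) := by cases n <;> simp
    simp only [Function.comp, this, zpow_natCast]

lemma continuous_qExp (hq : 1 < q) : Continuous (Eq' q) := by
  refine continuous_iff_continuousAt.2 fun z => ?_
  have h : ContinuousOn (Eq' q) (Metric.ball 0 (‖z‖ + 1)) := by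
    refine continuousOn_tsum (fun n => by fun_prop)
      (summable_norm_qExp hq ((‖z‖ + 1 : ℝ) : ℂ)) fun n x hx => ?_
    rw [norm_div, norm_div, norm_pow x, norm_pow (_ : ℂ) n, Complex.norm_real,
      Real.norm_of_nonneg (by positivity)]
    gcongr
    exact (mem_ball_zero_iff.1 hx).le
  exact h.continuousAt (Metric.isOpen_ball.mem_nhds (by simp))

lemma qExp_mul (hq : 1 < q) (z : ℂ) : Eq' q (q * z) = 1 + q * z * Eq' q z := by
  have hq0 : (q : ℂ) ≠ 0 := by exact_mod_cast (by linarith : q ≠ 0)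
  rw [Eq', (summable_norm_qExp hq _).of_norm.tsum_eq_zero_add, Eq', ← tsum_mul_left]
  congr 1
  · simp
  · refine tsum_congr fun n => ?_
    rw [Nat.triangle_succ, pow_add, mul_pow, pow_add (q : ℂ) _ n]
    field_simp

end QExponential

theorem cauchy_kernel_theta_representation (q : ℝ) (hq : 1 < q) (K α : ℝ) (hK : 0 < K)
    (hbound : ∀ ξ : ℂ, ξ ≠ 0 →
      ‖Eq' q ξ‖ ≤ K * Real.exp ((Real.log ‖ξ‖) ^ 2 / (2 * Real.log q)) * ‖ξ‖ ^ α)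
    (ω z : ℂ) (hω : ω ≠ 0) (hz : z ≠ 0) (hωz : ω ≠ z)
    (hmod : (q : ℝ) ^ (α - 1 / 2) < ‖ω / z‖)
    (d : ℝ) (hd : ∀ ℓ : ℤ, Complex.arg (ω / z) + d ≠ π + 2 * π * ℓ) :
    IntegrableOn (fun r : ℝ =>
        Eq' q (r * Complex.exp (Complex.I * d)) /
          jacobiThetaQ q (q * ω * (r * Complex.exp (Complex.I * d)) / z) *
          Complex.exp (Complex.I * d)) (Set.Ioi 0) ∧
    z / (ω - z) = (q / Real.log q) *
      ∫ r in Set.Ioi (0 : ℝ),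
        Eq' q (r * Complex.exp (Complex.I * d)) /
          jacobiThetaQ q (q * ω * (r * Complex.exp (Complex.I * d)) / z) *
          Complex.exp (Complex.I * d) := by
  have hq0 : 0 < q := by linarith
  have hqC : (q : ℂ) ≠ 0 := by exact_mod_cast hq0.ne'
  have hl := Real.log_pos hq
  have ha : ω / z ≠ 0 := div_ne_zero hω hz
  have ha0 : 0 < ‖ω / z‖ := norm_pos_iff.2 ha
  have hlC : (Real.log q : ℂ) ≠ 0 := by exact_mod_cast hl.ne'
  set l := Real.log q with hldef
  set a := ω / z with hadef
  set β := l + Real.log ‖a‖ with hβ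
  set θ := Complex.arg a + d with hθ
  have hexp (r : ℝ) (hr : 0 < r) : q * ω * (r * cexp (I * d)) / z =
      cexp ((Real.log r + β : ℝ) + θ * I) := by
    have h1 : a = ‖a‖ * cexp (Complex.arg a * I) := (Complex.norm_mul_exp_arg_mul_I a).symm
    have h2 : q * ω * (r * cexp (I * d)) / z = q * a * (r * cexp (I * d)) := by
      rw [hadef]; field_simp
    have h3 : cexp ((Real.log r + β : ℝ) + θ * I) =
        r * (q * ‖a‖) * (cexp (Complex.arg a * I) * cexp (I * d)) := by
      rw [Complex.exp_add, ← Complex.ofReal_exp, hβ, Real.exp_add, Real.exp_add, Real.exp_log hr,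
        Real.exp_log hq0, Real.exp_log ha0, ← Complex.exp_add, hθ]
      push_cast
      ring_nf
    rw [h2, h3]
    nth_rewrite 1 [h1]
    ring
  set g : ℝ → ℂ := fun r => Eq' q (r * cexp (I * d)) /
    jacobiThetaQ q (q * ω * (r * cexp (I * d)) / z) * cexp (I * d) with hg
  have hnormd : ‖cexp (I * d)‖ = 1 := by rw [mul_comm]; exact Complex.norm_exp_ofReal_mul_I d
  have hnormr (r : ℝ) (hr : 0 < r) : ‖(r : ℂ) * cexp (I * d)‖ = r := by
    rw [norm_mul, hnormd, mul_one, Complex.norm_real, Real.norm_of_nonneg hr.le]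
  have hθne (s : ℝ) := jacobiThetaQ_exp_ne_zero hq hd s
  have hgcont : ContinuousOn g (Set.Ioi 0) := by
    have h : ContinuousOn (fun r : ℝ => Eq' q (r * cexp (I * d)) /
        jacobiThetaQ q (cexp ((Real.log r + β : ℝ) + θ * I)) * cexp (I * d)) (Set.Ioi 0) := by
      refine ContinuousOn.mul (ContinuousOn.div ?_ ?_ fun r _ => hθne _) continuousOn_const
      · exact ((continuous_qExp hq).comp (by fun_prop)).continuousOn
      · refine (continuous_jacobiThetaQ_exp hq).comp_continuousOn ?_
        have : ContinuousOn Real.log (Set.Ioi 0) :=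
          Real.continuousOn_log.mono fun x hx => (Set.mem_Ioi.1 hx).ne'
        fun_prop
    exact h.congr fun r hr => by simp only [hg, hexp r hr]
  obtain ⟨C, hC, hCb⟩ := exists_jacobiThetaQ_lower_bound hq hd
  have hgnorm (r : ℝ) (hr : 0 < r) : ‖g r‖ ≤ ‖Eq' q (r * cexp (I * d))‖ *
      (C⁻¹ * Real.exp (-((Real.log r + β) ^ 2 / (2 * l) + (Real.log r + β) / 2))) := by
    rw [hg]
    simp only [hexp r hr]
    rw [norm_mul, hnormd, mul_one, norm_div, div_eq_mul_inv, Real.exp_neg, ← mul_inv]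
    gcongr
    exact hCb _
  have hint01 : IntegrableOn g (Set.Ioc 0 1) := by
    obtain ⟨M, hM⟩ := (isCompact_closedBall (0 : ℂ) 1).exists_bound_of_continuousOn
      (continuous_qExp hq).continuousOn
    refine (integrable_const (M * (C⁻¹ * Real.exp (l / 8)))).mono'
      ((hgcont.mono Set.Ioc_subset_Ioi_self).aestronglyMeasurable measurableSet_Ioc)
      ((ae_restrict_iff' measurableSet_Ioc).2 (ae_of_all _ fun r hr => (hgnorm r hr.1).trans ?_))
    have hM' := hM (r * cexp (I * d)) (by rw [mem_closedBall_zero_iff, hnormr r hr.1]; exact hr.2)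
    have hM0 : 0 ≤ M := (norm_nonneg _).trans hM'
    gcongr
    have : 0 ≤ (Real.log r + β + l / 2) ^ 2 / (2 * l) := by positivity
    have h2 : (Real.log r + β + l / 2) ^ 2 / (2 * l) =
      (Real.log r + β) ^ 2 / (2 * l) + (Real.log r + β) / 2 + l / 8 := by
      field_simp
      ring
    linarith
  have hint1 : IntegrableOn g (Set.Ioi 1) := by
    have hdecay : α - β / l - 1 / 2 < -1 := by
      have h := Real.log_lt_log (by positivity) hmod
      rw [Real.log_rpow hq0, ← hldef] at h
      have : α - 1 / 2 < Real.log ‖a‖ / l := (lt_div_iff₀ hl).2 h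
      have : β / l = 1 + Real.log ‖a‖ / l := by rw [hβ]; field_simp
      linarith
    refine ((integrableOn_Ioi_rpow_of_lt hdecay one_pos).const_mul
      (K * C⁻¹ * Real.exp (-(β ^ 2 / (2 * l) + β / 2)))).mono'
      ((hgcont.mono (Set.Ioi_subset_Ioi zero_le_one)).aestronglyMeasurable measurableSet_Ioi)
      ((ae_restrict_iff' measurableSet_Ioi).2 (ae_of_all _ fun r hr => ?_))
    have hr0 : 0 < r := one_pos.trans hr
    have hE := hbound (r * cexp (I * d)) (norm_pos_iff.1 (by rwa [hnormr r hr0]))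
    rw [hnormr r hr0] at hE
    refine (hgnorm r hr0).trans ((mul_le_mul_of_nonneg_right hE (by positivity)).trans_eq ?_)
    rw [Real.rpow_def_of_pos hr0, Real.rpow_def_of_pos hr0]
    have h : Real.exp (Real.log r ^ 2 / (2 * l)) * Real.exp (Real.log r * α) *
        Real.exp (-((Real.log r + β) ^ 2 / (2 * l) + (Real.log r + β) / 2)) =
        Real.exp (-(β ^ 2 / (2 * l) + β / 2)) * Real.exp (Real.log r * (α - β / l - 1 / 2)) := by
      simp only [← Real.exp_add]
      congr 1
      field_simp
      ring
    linear_combination K * C⁻¹ * h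
  have hint : IntegrableOn g (Set.Ioi 0) := by
    rw [← Set.Ioc_union_Ioi_eq_Ioi (zero_le_one' ℝ)]
    exact hint01.union hint1
  refine ⟨hint, ?_⟩
  have hstep (r : ℝ) (hr : 0 < r) : q • g (q * r) - a⁻¹ * g r = (q * a)⁻¹ *
      (r⁻¹ • (jacobiThetaQ q (cexp ((Real.log r + β : ℝ) + θ * I)))⁻¹) := by
    have hrC : (r : ℂ) ≠ 0 := by exact_mod_cast hr.ne'
    have hed := Complex.exp_ne_zero (I * d)
    have hT := hθne (Real.log r + β)
    have hy : q * ω * ((q * r : ℝ) * cexp (I * d)) / z = q * (q * ω * (r * cexp (I * d)) / z) := by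
      push_cast; ring
    have hE : ((q * r : ℝ) : ℂ) * cexp (I * d) = q * (r * cexp (I * d)) := by push_cast; ring
    have hval : cexp ((Real.log r + β : ℝ) + θ * I) = q * a * (r * cexp (I * d)) := by
      rw [← hexp r hr, hadef]; field_simp
    simp only [hg]
    rw [hy, hE, qExp_mul hq, hexp r hr, jacobiThetaQ_mul hq (Complex.exp_ne_zero _)]
    set T := jacobiThetaQ q (cexp ((Real.log r + β : ℝ) + θ * I))
    rw [hval, Complex.real_smul, Complex.real_smul]
    push_cast
    field_simp
    ring
  have hG : ∫ r in Set.Ioi (0 : ℝ),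
      r⁻¹ • (jacobiThetaQ q (cexp ((Real.log r + β : ℝ) + θ * I)))⁻¹ = l := by
    rw [integral_Ioi_inv_smul_comp_log fun s =>
        (jacobiThetaQ q (cexp ((s + β : ℝ) + θ * I)))⁻¹,
      integral_add_right_eq_self fun s : ℝ => (jacobiThetaQ q (cexp (s + θ * I)))⁻¹]
    exact integral_inv_jacobiThetaQ_exp hq hd
  have hintq : IntegrableOn (fun r => g (q * r)) (Set.Ioi 0) := by
    rw [integrableOn_Ioi_comp_mul_left_iff g 0 hq0, mul_zero]
    exact hint
  have hF := integral_comp_mul_left_Ioi' g 0 hq0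
  rw [mul_zero] at hF
  have hmain : (∫ r in Set.Ioi (0 : ℝ), g r) - a⁻¹ * ∫ r in Set.Ioi (0 : ℝ), g r =
      (q * a)⁻¹ * l := by
    nth_rewrite 1 [← hF]
    rw [← hG, ← integral_smul, ← integral_const_mul, ← integral_const_mul,
      ← integral_sub (by exact hintq.smul q) (hint.const_mul _)]
    exact setIntegral_congr_fun measurableSet_Ioi fun r hr => hstep r hr
  have haz : a * z = ω := div_mul_cancel₀ ω hz
  have hsub : ω - z ≠ 0 := sub_ne_zero.2 hωz
  change z / (ω - z) = q / l * ∫ r in Set.Ioi (0 : ℝ), g r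
  set F := ∫ r in Set.Ioi (0 : ℝ), g r
  have hF' : q * F * (a - 1) = l := by
    field_simp at hmain
    linear_combination hmain
  rw [div_eq_iff hsub, ← haz]
  field_simp
  linear_combination -hF'
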